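/- Let k, ℓ be coprime positive integers, u, v the unique positive integers with ku − ℓv = 1, u ≤ ℓ, v ≤ k, and n ≥ 1 an integer. Define δ = ∑_{m=0}^{kℓn−1} ( ](ℓ−u)(m − kℓn)/ℓ] − [(k−v)(m − kℓn)/k[ ), where [x[ = ⌊x⌋ and ]x] = ⌈x⌉ − 1, and δ' = n(kℓn − 1) − ∑_{m=1}^{kℓn−1} e_m, where e_m is the number of pairs (i,j) of nonnegative integers with ki + ℓj = m. Then δ = n²kℓ − ∑_{m=0}^{kℓn−1} e_m, and consequently δ − δ' = n − 1. -/

import Mathlib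

/-- `eCount k l m` is the number of pairs `(i,j)` of nonnegative integers
with `k*i + l*j = m`. -/
noncomputable def eCount (k l m : ℕ) : ℕ :=
  Nat.card {p : ℕ × ℕ // k * p.1 + l * p.2 = m}

/-- If `k * u - l * v = 1`, the solutions of `k * i + l * j = m` in nonnegative integers are
`i = u * m - l * t`, `j = k * t - v * m` with `v * m / k ≤ t ≤ u * m / l`. -/
lemma eCount_eq_floor_sub_ceil {k l u v : ℕ} (hk : 0 < k) (hl : 0 < l)
    (huv : k * u = l * v + 1) (m : ℕ) :
    (eCount k l m : ℤ) = ⌊(u : ℚ) * m / l⌋ - ⌈(v : ℚ) * m / k⌉ + 1 := by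
  have huv' : (k : ℤ) * u = l * v + 1 := by exact_mod_cast huv
  have hkQ : (0 : ℚ) < k := by exact_mod_cast hk
  have hlQ : (0 : ℚ) < l := by exact_mod_cast hl
  have mem_iff (t : ℤ) : t ∈ Finset.Icc ⌈(v : ℚ) * m / k⌉ ⌊(u : ℚ) * m / l⌋ ↔
      (v : ℤ) * m ≤ k * t ∧ (l : ℤ) * t ≤ u * m := by
    rw [Finset.mem_Icc, Int.ceil_le, Int.le_floor, div_le_iff₀ hkQ, le_div_iff₀ hlQ,
      mul_comm (t : ℚ) k, mul_comm (t : ℚ) l]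
    norm_cast
  have hle : ⌈(v : ℚ) * m / k⌉ ≤ ⌊(u : ℚ) * m / l⌋ + 1 := by
    have hvu : (v : ℚ) * m / k ≤ (u : ℚ) * m / l := by
      rw [div_le_div_iff₀ hkQ hlQ]
      have huvQ : (k : ℚ) * u = l * v + 1 := by exact_mod_cast huv
      have hm : (0 : ℚ) ≤ m := m.cast_nonneg
      linear_combination hm + (-m : ℚ) * huvQ
    rw [Int.ceil_le]
    push_cast
    exact hvu.trans (Int.lt_floor_add_one _).le
  let e : {p : ℕ × ℕ // k * p.1 + l * p.2 = m} ≃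
      {t : ℤ // t ∈ Finset.Icc ⌈(v : ℚ) * m / k⌉ ⌊(u : ℚ) * m / l⌋} :=
    { toFun := fun p ↦ ⟨v * p.1.1 + u * p.1.2, by
        obtain ⟨⟨i, j⟩, h⟩ := p
        have h' : (k : ℤ) * i + l * j = m := by exact_mod_cast h
        have hi : (0 : ℤ) ≤ i := i.cast_nonneg
        have hj : (0 : ℤ) ≤ j := j.cast_nonneg
        rw [mem_iff]
        constructor
        · linear_combination hj - (v : ℤ) * h' - (j : ℤ) * huv'
        · linear_combination hi - (i : ℤ) * huv' + (u : ℤ) * h'⟩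
      invFun := fun t ↦ ⟨(((u : ℤ) * m - l * t.1).toNat, ((k : ℤ) * t.1 - v * m).toNat), by
        obtain ⟨h₁, h₂⟩ := (mem_iff t.1).1 t.2
        zify
        rw [Int.toNat_of_nonneg (by linarith), Int.toNat_of_nonneg (by linarith)]
        linear_combination (m : ℤ) * huv'⟩
      left_inv := by
        rintro ⟨⟨i, j⟩, h⟩
        have h' : (k : ℤ) * i + l * j = m := by exact_mod_cast h
        have hi : (u : ℤ) * m - l * (v * i + u * j) = i := by
          linear_combination (i : ℤ) * huv' - (u : ℤ) * h'
        have hj : (k : ℤ) * (v * i + u * j) - v * m = j := by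
          linear_combination (j : ℤ) * huv' + (v : ℤ) * h'
        simp [hi, hj]
      right_inv := by
        rintro ⟨t, ht⟩
        obtain ⟨h₁, h₂⟩ := (mem_iff t).1 ht
        ext
        simp only
        rw [Int.toNat_of_nonneg (by linarith), Int.toNat_of_nonneg (by linarith)]
        linear_combination t * huv' }
  rw [eCount, Nat.card_congr e, Nat.card_eq_fintype_card, Fintype.card_coe,
    Int.card_Icc_of_le _ _ hle]
  ring

/-- The summand of `δ` at `m` equals `n - e_m`. -/
lemma ceil_sub_one_sub_floor_eq {k l u v : ℕ} (hk : 0 < k) (hl : 0 < l)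
    (huv : k * u = l * v + 1) (n m : ℕ) :
    (⌈((l : ℚ) - u) * ((m : ℚ) - k * l * n) / l⌉ - 1) -
      ⌊((k : ℚ) - v) * ((m : ℚ) - k * l * n) / k⌋ = (n : ℤ) - eCount k l m := by
  have huv' : (k : ℤ) * u = l * v + 1 := by exact_mod_cast huv
  have hkQ : (k : ℚ) ≠ 0 := by exact_mod_cast hk.ne'
  have hlQ : (l : ℚ) ≠ 0 := by exact_mod_cast hl.ne'
  have h₁ : ((l : ℚ) - u) * ((m : ℚ) - k * l * n) / l =
      -((u : ℚ) * m / l) + ((m - k * l * n + u * k * n : ℤ) : ℚ) := by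
    push_cast
    field_simp
    ring
  have h₂ : ((k : ℚ) - v) * ((m : ℚ) - k * l * n) / k =
      -((v : ℚ) * m / k) + ((m - k * l * n + v * l * n : ℤ) : ℚ) := by
    push_cast
    field_simp
    ring
  rw [h₁, h₂, Int.ceil_add_intCast, Int.floor_add_intCast, Int.ceil_neg, Int.floor_neg,
    eCount_eq_floor_sub_ceil hk hl huv]
  linear_combination (n : ℤ) * huv'

lemma eCount_zero {k l : ℕ} (hk : 0 < k) (hl : 0 < l) : eCount k l 0 = 1 := by
  rw [eCount, Nat.card_eq_one_iff_exists]
  refine ⟨⟨(0, 0), by simp⟩, ?_⟩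
  rintro ⟨⟨i, j⟩, h⟩
  simpa [hk.ne', hl.ne'] using h

/-- with `k, l` coprime positive integers, `u, v` the unique
positive integers with `k*u - l*v = 1`, `u ≤ l`, `v ≤ k`, and `n ≥ 1`, set
`δ = ∑_{m=0}^{kln-1} ( ](l-u)(m-kln)/l] - [(k-v)(m-kln)/k[ )` (where `[x[ = ⌊x⌋`
and `]x] = ⌈x⌉ - 1`) and `δ' = n(kln-1) - ∑_{m=1}^{kln-1} e_m`.  Then
`δ = n²kl - ∑_{m=0}^{kln-1} e_m` and consequently `δ - δ' = n - 1`. -/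
theorem mattei_dimension_count (k l u v n : ℕ) (hk : 0 < k) (hl : 0 < l)
    (hkl : Nat.Coprime k l) (hu : 0 < u) (hv : 0 < v)
    (huv : k * u = l * v + 1) (hul : u ≤ l) (hvk : v ≤ k) (hn : 1 ≤ n) :
    (∑ m ∈ Finset.range (k * l * n),
        ((⌈((l : ℚ) - u) * ((m : ℚ) - k * l * n) / l⌉ - 1) -
          ⌊((k : ℚ) - v) * ((m : ℚ) - k * l * n) / k⌋)) =
      (n : ℤ) ^ 2 * k * l - ∑ m ∈ Finset.range (k * l * n), (eCount k l m : ℤ) ∧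
    (∑ m ∈ Finset.range (k * l * n),
        ((⌈((l : ℚ) - u) * ((m : ℚ) - k * l * n) / l⌉ - 1) -
          ⌊((k : ℚ) - v) * ((m : ℚ) - k * l * n) / k⌋)) -
      ((n : ℤ) * (k * l * n - 1) -
        ∑ m ∈ Finset.Icc 1 (k * l * n - 1), (eCount k l m : ℤ)) =
      n - 1 := by
  have hδ : (∑ m ∈ Finset.range (k * l * n),
        ((⌈((l : ℚ) - u) * ((m : ℚ) - k * l * n) / l⌉ - 1) -
          ⌊((k : ℚ) - v) * ((m : ℚ) - k * l * n) / k⌋)) =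
      (n : ℤ) ^ 2 * k * l - ∑ m ∈ Finset.range (k * l * n), (eCount k l m : ℤ) := by
    rw [Finset.sum_congr rfl fun m _ ↦ ceil_sub_one_sub_floor_eq hk hl huv n m,
      Finset.sum_sub_distrib, Finset.sum_const, Finset.card_range, nsmul_eq_mul]
    push_cast
    ring
  refine ⟨hδ, ?_⟩
  have hN : 0 < k * l * n := by positivity
  have hsum : ∑ m ∈ Finset.range (k * l * n), (eCount k l m : ℤ) =
      1 + ∑ m ∈ Finset.Icc 1 (k * l * n - 1), (eCount k l m : ℤ) := by
    have hIcc : Finset.Icc 1 (k * l * n - 1) = Finset.Ico 1 (k * l * n) := by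
      ext m
      simp only [Finset.mem_Icc, Finset.mem_Ico]
      omega
    rw [hIcc, Finset.range_eq_Ico, Finset.sum_eq_sum_Ico_succ_bot hN, eCount_zero hk hl]
    simp
  rw [hδ, hsum]
  ring
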